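/- Fix a nonnegative integer s. Let m ≥ 2 be an integer and n = 2^m − 1, and let T_n ∈ ℚ₂ be the Volkenborn integral of B_n^{(s)}(t + 1/4), i.e. T_n = lim_{M→∞} 2^{−M} · ∑_{k=0}^{2^M−1} B_n^{(s)}(k + 1/4), the limit taken in ℚ₂ (each value B_n^{(s)}(k+1/4) is a rational number viewed in ℚ₂). Then this limit exists, T_n ≠ 0, and v₂(d_n^{2s+3} · T_n) = (6s+12)·n + s + v₂((s+2)!). -/

import Mathlib

open Filter Finset

/-- Pochhammer symbol `(α)_k = α (α+1) ⋯ (α+k-1)` for real `α`. -/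
noncomputable def pochR (α : ℝ) (k : ℕ) : ℝ := ∏ i ∈ Finset.range k, (α + i)

/-- The rational function `B_n(t) = 2^{(3s+6)n} (t+3/4)_n^{s+2} / (t)_{n+1}^{s+2}`,
as a function of a real variable. -/
noncomputable def BRealfun (s n : ℕ) (t : ℝ) : ℝ :=
  2 ^ ((3 * s + 6) * n) * pochR (t + 3/4) n ^ (s + 2) / pochR t (n + 1) ^ (s + 2)

/-- `dlcm n = lcm(1, 2, …, n)`. -/
def dlcm (n : ℕ) : ℕ := (Finset.Icc 1 n).lcm id

/-- functions with a first-order expansion -/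
def C2 {A : Type*} [CommRing A] (f : ℕ → A) : Prop :=
  ∃ f1 : ℕ → A, ∀ x h : ℕ, ((h : A) ^ 2 ∣ f (x + h) - f x - h * f1 x) ∧
    ((h : A) ∣ f1 (x + h) - f1 x)

namespace C2
variable {A : Type*} [CommRing A]

theorem lip {f : ℕ → A} (hf : C2 f) (x h : ℕ) : (h : A) ∣ f (x + h) - f x := by
  obtain ⟨f1, H⟩ := hf
  obtain ⟨c, hc⟩ := (H x h).1
  exact ⟨f1 x + h * c, by linear_combination hc⟩

theorem const (a : A) : C2 (fun _ => a) := ⟨fun _ => 0, fun x h => by simp⟩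

theorem lin (a b : A) : C2 (fun y => a + (y : A) * b) :=
  ⟨fun _ => b, fun x h => by
    constructor
    · refine ⟨0, ?_⟩
      push_cast; ring
    · simp⟩

theorem add {f g : ℕ → A} (hf : C2 f) (hg : C2 g) : C2 (fun x => f x + g x) := by
  obtain ⟨f1, hf⟩ := hf
  obtain ⟨g1, hg⟩ := hg
  refine ⟨fun x => f1 x + g1 x, fun x h => ?_⟩
  obtain ⟨⟨a, ha⟩, ⟨b, hb⟩⟩ := hf x h
  obtain ⟨⟨c, hc⟩, ⟨d, hd⟩⟩ := hg x h
  exact ⟨⟨a + c, by linear_combination ha + hc⟩, ⟨b + d, by linear_combination hb + hd⟩⟩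

theorem mul {f g : ℕ → A} (hf : C2 f) (hg : C2 g) : C2 (fun x => f x * g x) := by
  have hlf := hf.lip
  have hlg := hg.lip
  obtain ⟨f1, hf⟩ := hf
  obtain ⟨g1, hg⟩ := hg
  refine ⟨fun x => f1 x * g x + f x * g1 x, fun x h => ?_⟩
  obtain ⟨⟨a, ha⟩, ⟨b, hb⟩⟩ := hf x h
  obtain ⟨⟨c, hc⟩, ⟨d, hd⟩⟩ := hg x h
  obtain ⟨p, hp⟩ := hlf x h
  obtain ⟨q, hq⟩ := hlg x h
  refine ⟨⟨a * g x + f x * c + p * q, ?_⟩, ⟨b * g (x + h) + f1 x * q + p * g1 (x + h) + f x * d, ?_⟩⟩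
  · linear_combination g x * ha + f x * hc + (g (x + h) - g x) * hp + h * p * hq
  · linear_combination g (x + h) * hb + f1 x * hq + g1 (x + h) * hp + f x * hd

theorem inv {f g : ℕ → A} (hf : C2 f) (hfg : ∀ x, f x * g x = 1) : C2 g := by
  have hlf := hf.lip
  obtain ⟨f1, hf⟩ := hf
  refine ⟨fun x => - (f1 x * g x ^ 2), fun x h => ?_⟩
  obtain ⟨⟨a, ha⟩, ⟨b, hb⟩⟩ := hf x h
  obtain ⟨p, hp⟩ := hlf x h
  have h1 := hfg x
  have h2 := hfg (x + h)
  have hq : g (x + h) - g x = h * (- p * g x * g (x + h)) := by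
    linear_combination (- g x * g (x + h)) * hp - g (x+h) * h1 + g x * h2
  set q := - p * g x * g (x + h)
  refine ⟨⟨-(g x * f1 x * q) - a * g x * g (x + h), ?_⟩,
    ⟨- b * g (x + h) ^ 2 - f1 x * q * (g (x + h) + g x), ?_⟩⟩
  · linear_combination (- g x * g (x + h)) * ha - g (x+h) * h1 + g x * h2 - (h * f1 x * g x) * hq
  · linear_combination (- g (x + h) ^ 2) * hb - f1 x * (g (x + h) + g x) * hq

theorem pow {f : ℕ → A} (hf : C2 f) (k : ℕ) : C2 (fun x => f x ^ k) := by
  induction k with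
  | zero => simpa using const (1 : A)
  | succ k ih => simpa [pow_succ] using ih.mul hf

theorem prod {ι : Type*} (s : Finset ι) (f : ι → ℕ → A) (hf : ∀ i ∈ s, C2 (f i)) :
    C2 (fun x => ∏ i ∈ s, f i x) := by
  classical
  induction s using Finset.induction_on with
  | empty => simpa using const (1 : A)
  | insert a s ha ih =>
    simp only [Finset.prod_insert ha]
    exact (hf a (by simp)).mul (ih fun i hi => hf i (by simp [hi]))

theorem sum {ι : Type*} (s : Finset ι) (f : ι → ℕ → A) (hf : ∀ i ∈ s, C2 (f i)) :
    C2 (fun x => ∑ i ∈ s, f i x) := by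
  classical
  induction s using Finset.induction_on with
  | empty => simpa using const (0 : A)
  | insert a s ha ih =>
    simp only [Finset.sum_insert ha]
    exact (hf a (by simp)).add (ih fun i hi => hf i (by simp [hi]))

theorem comp_mul {f : ℕ → A} (hf : C2 f) (d : ℕ) : C2 (fun x => f (d * x)) := by
  obtain ⟨f1, hf⟩ := hf
  refine ⟨fun x => d * f1 (d * x), fun x h => ?_⟩
  obtain ⟨⟨a, ha⟩, ⟨b, hb⟩⟩ := hf (d * x) (d * h)
  simp only [mul_add]
  push_cast at ha hb
  exact ⟨⟨d ^ 2 * a, by linear_combination ha⟩, ⟨d ^ 2 * b, by linear_combination d * hb⟩⟩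

theorem map {B : Type*} [CommRing B] (φ : A →+ B) {f : ℕ → A} (hf : C2 f) :
    C2 (fun x => φ (f x)) := by
  have key : ∀ (h : ℕ) (a : A), φ ((h : A) * a) = h * φ a := fun h a => by
    rw [← nsmul_eq_mul, ← nsmul_eq_mul, map_nsmul]
  obtain ⟨f1, hf⟩ := hf
  refine ⟨fun x => φ (f1 x), fun x h => ?_⟩
  obtain ⟨⟨a, ha⟩, ⟨b, hb⟩⟩ := hf x h
  refine ⟨⟨φ a, ?_⟩, ⟨φ b, ?_⟩⟩
  · rw [← key, ← map_sub, ← map_sub, ha, ← Nat.cast_pow, key, Nat.cast_pow]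
  · rw [← map_sub, hb, key]

end C2

open Filter

theorem sum_two_pow {A : Type*} [CommRing A] (f : ℕ → A) (N : ℕ) :
    ∑ u ∈ Finset.range (2 ^ (N + 1)), f u - 2 * ∑ u ∈ Finset.range (2 ^ N), f u =
      ∑ u ∈ Finset.range (2 ^ N), (f (u + 2 ^ N) - f u) := by
  rw [pow_succ, mul_two, Finset.sum_range_add, Finset.sum_sub_distrib]
  simp only [add_comm]
  ring

theorem lip_sum {A : Type*} [CommRing A] (f : ℕ → A) (hf : ∀ x h : ℕ, (h : A) ∣ f (x + h) - f x)
    (N : ℕ) : (2 : A) ^ N ∣ 2 * ∑ u ∈ Finset.range (2 ^ N), f u := by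
  induction N with
  | zero => simp
  | succ N ih =>
    have h1 := sum_two_pow f N
    have h2 : (2 : A) ^ N ∣ ∑ u ∈ Finset.range (2 ^ N), (f (u + 2 ^ N) - f u) :=
      Finset.dvd_sum fun u _ => by simpa using hf u (2 ^ N)
    have h3 : 2 * ∑ u ∈ Finset.range (2 ^ (N + 1)), f u =
      2 * (2 * ∑ u ∈ Finset.range (2 ^ N), f u
        + ∑ u ∈ Finset.range (2 ^ N), (f (u + 2 ^ N) - f u)) := by
      rw [← h1]; ring
    rw [h3, pow_succ, mul_comm]
    exact mul_dvd_mul_left _ (dvd_add ih h2)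

/-- the inclusion of `ℤ₂` in `ℚ₂` -/
noncomputable def io : ℤ_[2] →+* ℚ_[2] := PadicInt.Coe.ringHom

theorem norm_io (x : ℤ_[2]) : ‖io x‖ = ‖x‖ := rfl

theorem io_injective : Function.Injective io := Subtype.val_injective

/-- Volkenborn partial sums -/
noncomputable def VS (f : ℕ → ℤ_[2]) (N : ℕ) : ℚ_[2] :=
  (2 ^ N : ℚ_[2])⁻¹ * io (∑ u ∈ Finset.range (2 ^ N), f u)

theorem norm_le_of_dvd (k : ℕ) (x : ℤ_[2]) (h : (2 : ℤ_[2]) ^ k ∣ x) :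
    ‖io x‖ ≤ ((2 : ℝ) ^ k)⁻¹ := by
  obtain ⟨c, rfl⟩ := h
  have h2 : ‖(2 : ℚ_[2])‖ = 2⁻¹ := by simpa using Padic.norm_p (p := 2)
  rw [map_mul, map_pow, map_ofNat, norm_mul, norm_pow, h2, inv_pow]
  have : ‖io c‖ ≤ 1 := c.2
  exact mul_le_of_le_one_right (by positivity) this

theorem n2 : ‖(2 : ℚ_[2])‖ = 2⁻¹ := by simpa using Padic.norm_p (p := 2)

theorem VS_diff (f : ℕ → ℤ_[2]) (N : ℕ) : VS f (N + 1) - VS f N = (2 ^ (N + 1) : ℚ_[2])⁻¹ *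
    io (∑ u ∈ Finset.range (2 ^ N), (f (u + 2 ^ N) - f u)) := by
  rw [← sum_two_pow]
  unfold VS
  generalize (∑ u ∈ Finset.range (2 ^ N), f u : ℤ_[2]) = a
  generalize (∑ u ∈ Finset.range (2 ^ (N + 1)), f u : ℤ_[2]) = b
  rw [map_sub, map_mul, map_ofNat]
  have : (2 : ℚ_[2]) ≠ 0 := two_ne_zero
  field_simp
  ring

theorem VS_bound {f : ℕ → ℤ_[2]} (hf : C2 f) (N : ℕ) : ‖VS f N‖ ≤ 2 := by
  have := norm_le_of_dvd N _ (lip_sum f hf.lip N)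
  rw [map_mul, map_ofNat, norm_mul, n2] at this
  unfold VS
  rw [norm_mul, norm_inv, norm_pow, n2, inv_pow, inv_inv]
  calc _ = 2 * 2 ^ N * (2⁻¹ * ‖io (∑ u ∈ Finset.range (2 ^ N), f u)‖) := by ring
    _ ≤ 2 * 2 ^ N * (2 ^ N)⁻¹ := by gcongr
    _ = 2 := by field_simp

theorem VS_tendsto {f : ℕ → ℤ_[2]} (hf : C2 f) :
    ∃ I : ℚ_[2], Tendsto (VS f) atTop (nhds I) ∧ ‖I‖ ≤ 2 := by
  have hc : CauchySeq (VS f) := by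
    refine cauchySeq_of_le_geometric (2⁻¹) 4 (by norm_num) fun N => ?_
    rw [dist_comm, dist_eq_norm, VS_diff]
    obtain ⟨f1, H⟩ := hf
    have h1 : (2 : ℤ_[2]) ^ (2 * N) ∣ 2 * ∑ u ∈ Finset.range (2 ^ N), (f (u + 2 ^ N) - f u) := by
      have e : 2 * ∑ u ∈ Finset.range (2 ^ N), (f (u + 2 ^ N) - f u) =
        2 * ∑ u ∈ Finset.range (2 ^ N), (f (u + 2 ^ N) - f u - (2 ^ N : ℕ) * f1 u) +
          2 ^ N * (2 * ∑ u ∈ Finset.range (2 ^ N), f1 u) := by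
        rw [Finset.sum_sub_distrib _ (fun u => ((2 ^ N : ℕ) : ℤ_[2]) * f1 u), ← Finset.mul_sum]
        push_cast; ring
      rw [e]
      refine dvd_add (Dvd.dvd.mul_left (Finset.dvd_sum fun u _ => ?_) _) ?_
      · have := (H u (2 ^ N)).1
        rw [mul_comm, pow_mul]
        simpa using this
      · rw [two_mul, pow_add]
        exact mul_dvd_mul_left _ (lip_sum f1 (fun x h => (H x h).2) N)
    have := norm_le_of_dvd _ _ h1
    generalize (∑ u ∈ Finset.range (2 ^ N), (f (u + 2 ^ N) - f u) : ℤ_[2]) = b at *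
    rw [map_mul, map_ofNat, norm_mul, n2] at this
    rw [norm_mul, norm_inv, norm_pow, n2, inv_pow, inv_inv]
    calc _ = 4 * 2 ^ N * (2⁻¹ * ‖io b‖) := by ring
      _ ≤ 4 * 2 ^ N * (2 ^ (2 * N))⁻¹ := by gcongr
      _ = 4 * 2⁻¹ ^ N := by
        rw [two_mul, pow_add, inv_pow]
        field_simp
  obtain ⟨I, hI⟩ := cauchySeq_tendsto_of_complete hc
  exact ⟨I, hI, le_of_tendsto hI.norm (Eventually.of_forall (VS_bound hf))⟩

theorem VS_unit {f : ℕ → ℤ_[2]} (hf : ∀ u h : ℕ, (4 * h : ℤ_[2]) ∣ f (u + h) - f u)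
    (h0 : IsUnit (f 0)) {I : ℚ_[2]} (hI : Tendsto (VS f) atTop (nhds I)) : ‖I‖ = 1 := by
  have hb : ∀ N, ‖VS f N - io (f 0)‖ ≤ 2⁻¹ := by
    intro N
    induction N with
    | zero => simp [VS]
    | succ N ih =>
      have : VS f (N + 1) - io (f 0) = (VS f (N + 1) - VS f N) + (VS f N - io (f 0)) := by
        ring
      rw [this]
      refine (Padic.nonarchimedean _ _).trans (max_le ?_ ih)
      rw [VS_diff]
      have h1 : (2 : ℤ_[2]) ^ (N + 2) ∣ ∑ u ∈ Finset.range (2 ^ N), (f (u + 2 ^ N) - f u) :=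
        Finset.dvd_sum fun u _ => by
          have := hf u (2 ^ N)
          push_cast at this
          convert this using 1
          ring
      have := norm_le_of_dvd _ _ h1
      generalize (∑ u ∈ Finset.range (2 ^ N), (f (u + 2 ^ N) - f u) : ℤ_[2]) = b at *
      rw [norm_mul, norm_inv, norm_pow, n2, inv_pow, inv_inv]
      calc _ ≤ (2 : ℝ) ^ (N + 1) * (2 ^ (N + 2))⁻¹ := by gcongr
        _ = 2⁻¹ := by
          rw [pow_succ _ (N+1)]
          field_simp
  have h2 : ‖I - io (f 0)‖ ≤ 2⁻¹ :=
    le_of_tendsto (hI.sub_const _).norm (Eventually.of_forall hb)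
  have h3 : ‖io (f 0)‖ = 1 := by
    have := PadicInt.isUnit_iff.1 h0
    rw [norm_io]; exact this
  have h4 : I = (I - io (f 0)) + io (f 0) := by ring
  rw [h4, Padic.add_eq_max_of_ne (by rw [h3]; intro h; rw [h] at h2; norm_num at h2), h3]
  exact max_eq_right (h2.trans (by norm_num))
/-- Taylor series -/
noncomputable def tay (x : ℝ) (f : ℝ → ℝ) : PowerSeries ℝ :=
  PowerSeries.mk fun k => iteratedDeriv k f x / (k.factorial : ℝ)

theorem tay_mul (x : ℝ) (f g : ℝ → ℝ) (hf : ∀ k : ℕ, ContDiffAt ℝ k f x)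
    (hg : ∀ k : ℕ, ContDiffAt ℝ k g x) : tay x (fun t => f t * g t) = tay x f * tay x g := by
  ext k
  rw [PowerSeries.coeff_mul]
  simp only [tay, PowerSeries.coeff_mk]
  rw [iteratedDeriv_fun_mul (hf k) (hg k), Finset.Nat.sum_antidiagonal_eq_sum_range_succ
    (fun i j => iteratedDeriv i f x / (i.factorial : ℝ) * (iteratedDeriv j g x / (j.factorial : ℝ))),
    Finset.sum_div]
  refine Finset.sum_congr rfl fun i hi => ?_
  have hi : i ≤ k := by simpa [Nat.lt_succ_iff] using hi
  rw [Nat.cast_choose ℝ hi]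
  have h1 : (k.factorial : ℝ) ≠ 0 := by positivity
  have h2 : (i.factorial : ℝ) ≠ 0 := by positivity
  have h3 : ((k - i).factorial : ℝ) ≠ 0 := by positivity
  field_simp

theorem tay_const (x c : ℝ) : tay x (fun _ => c) = PowerSeries.C c := by
  ext k
  simp only [tay, PowerSeries.coeff_mk, PowerSeries.coeff_C, iteratedDeriv_const]
  split_ifs with h
  · simp [h]
  · simp

theorem tay_lin (x c : ℝ) : tay x (fun t => t + c) = PowerSeries.C (x + c) + PowerSeries.X := by
  ext k
  simp only [tay, PowerSeries.coeff_mk, map_add, PowerSeries.coeff_C, PowerSeries.coeff_X]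
  rcases k with _ | _ | k
  · simp
  · simp [iteratedDeriv_one]
  · have : deriv (fun t : ℝ => t + c) = fun _ => 1 := by ext; simp
    rw [iteratedDeriv_succ', this, iteratedDeriv_const]
    simp

/-- formal Pochhammer product -/
noncomputable def NP {K : Type*} [CommRing K] (x : K) (n : ℕ) : PowerSeries K :=
  ∏ i ∈ Finset.range n, (PowerSeries.C (x + i) + PowerSeries.X)

theorem NP_map {K L : Type*} [CommRing K] [CommRing L] (φ : K →+* L) (x : K) (n : ℕ) :
    PowerSeries.map φ (NP x n) = NP (φ x) n := by
  simp [NP, map_prod]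

theorem tay_poch (x c : ℝ) (n : ℕ) : (∀ k : ℕ, ContDiffAt ℝ k (fun t => pochR (t + c) n) x) ∧
    tay x (fun t => pochR (t + c) n) = NP (x + c) n := by
  induction n with
  | zero =>
    simp only [pochR, NP, Finset.range_zero, Finset.prod_empty]
    exact ⟨fun k => contDiffAt_const, by rw [tay_const]; simp⟩
  | succ n ih =>
    have e : (fun t => pochR (t + c) (n + 1)) = fun t => pochR (t + c) n * (t + (c + n)) := by
      ext t; simp only [pochR, Finset.prod_range_succ]; ring
    have hl : ∀ k : ℕ, ContDiffAt ℝ k (fun t : ℝ => t + (c + n)) x := fun k => by fun_prop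
    rw [e]
    refine ⟨fun k => (ih.1 k).mul (hl k), ?_⟩
    rw [tay_mul x _ _ ih.1 hl, ih.2, tay_lin, NP, NP, Finset.prod_range_succ]
    simp [add_assoc]

theorem tay_pow (x : ℝ) (f : ℝ → ℝ) (hf : ∀ k : ℕ, ContDiffAt ℝ k f x) (a : ℕ) :
    (∀ k : ℕ, ContDiffAt ℝ k (fun t => f t ^ a) x) ∧ tay x (fun t => f t ^ a) = tay x f ^ a := by
  induction a with
  | zero => simp only [pow_zero]; exact ⟨fun k => contDiffAt_const, by rw [tay_const]; simp⟩
  | succ a ih =>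
    simp only [pow_succ]
    exact ⟨fun k => (ih.1 k).mul (hf k), by rw [tay_mul x _ _ ih.1 hf, ih.2]⟩

/-- formal expansion of `B_n` -/
noncomputable def Bps {K : Type*} [Field K] (s n : ℕ) (x : K) : PowerSeries K :=
  PowerSeries.C (2 ^ ((3 * s + 6) * n)) * NP (x + 3 / 4) n ^ (s + 2) * (NP x (n + 1) ^ (s + 2))⁻¹

theorem Bps_spec {K : Type*} [Field K] (s n : ℕ) (x : K) (hx : ∀ i : ℕ, x + i ≠ 0) :
    Bps s n x * NP x (n + 1) ^ (s + 2) =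
      PowerSeries.C (2 ^ ((3 * s + 6) * n)) * NP (x + 3 / 4) n ^ (s + 2) := by
  rw [Bps, mul_assoc, PowerSeries.inv_mul_cancel, mul_one]
  rw [map_pow]
  refine pow_ne_zero _ ?_
  rw [NP, map_prod]
  refine Finset.prod_ne_zero_iff.2 fun i _ => ?_
  simpa using hx i

theorem NP_ne {K : Type*} [Field K] (x : K) (n : ℕ) : NP x n ≠ 0 := by
  refine Finset.prod_ne_zero_iff.2 fun i _ h => ?_
  have := congrArg (PowerSeries.coeff 1) h
  rw [map_add, PowerSeries.coeff_C, PowerSeries.coeff_one_X] at this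
  simp at this

theorem Bps_map {K L : Type*} [Field K] [Field L] (φ : K →+* L) (s n : ℕ) (x : K)
    (hx : ∀ i : ℕ, x + i ≠ 0) : PowerSeries.map φ (Bps s n x) = Bps s n (φ x) := by
  have hx' : ∀ i : ℕ, φ x + i ≠ 0 := fun i h => hx i (φ.injective (by simpa using h))
  have h1 := congrArg (PowerSeries.map φ) (Bps_spec s n x hx)
  have h2 := Bps_spec s n (φ x) hx'
  simp only [map_mul, map_pow, NP_map, PowerSeries.map_C] at h1
  refine mul_right_cancel₀ (pow_ne_zero (s + 2) (NP_ne (φ x) (n + 1))) ?_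
  rw [h1, h2]
  have e2 : φ 2 = 2 := map_ofNat φ 2
  have e3 : φ 3 = 3 := map_ofNat φ 3
  have e4 : φ 4 = 4 := map_ofNat φ 4
  rw [map_add, map_div₀, e3, e4, e2, map_pow]

theorem tay_B (s n : ℕ) (x : ℝ) (hx : 0 < x) : tay x (BRealfun s n) = Bps s n x := by
  have hp : pochR x (n + 1) ≠ 0 := by
    rw [pochR]
    exact Finset.prod_ne_zero_iff.2 fun i _ => by positivity
  have hN := tay_poch x (3 / 4) n
  have hD := tay_poch x 0 (n + 1)
  simp only [add_zero] at hD
  have hNp := tay_pow x _ hN.1 (s + 2)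
  have hDp := tay_pow x _ hD.1 (s + 2)
  have hc : ∀ k : ℕ, ContDiffAt ℝ k (fun _ : ℝ => (2 : ℝ) ^ ((3 * s + 6) * n)) x :=
    fun k => contDiffAt_const
  have hnum : ∀ k : ℕ, ContDiffAt ℝ k
      (fun t => 2 ^ ((3 * s + 6) * n) * pochR (t + 3 / 4) n ^ (s + 2)) x :=
    fun k => (hc k).mul (hNp.1 k)
  have hB : ∀ k : ℕ, ContDiffAt ℝ k (BRealfun s n) x := fun k =>
    (hnum k).div (hDp.1 k) (pow_ne_zero _ hp)
  refine mul_right_cancel₀ (pow_ne_zero (s + 2) (NP_ne x (n + 1))) ?_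
  rw [Bps_spec s n x (fun i => by positivity), ← hD.2, ← hDp.2, ← tay_mul x _ _ hB hDp.1,
    ← hN.2, ← hNp.2, ← tay_const x, ← tay_mul x _ _ hc hNp.1]
  ext k
  simp only [tay, PowerSeries.coeff_mk]
  congr 1
  refine Filter.EventuallyEq.iteratedDeriv_eq k ?_
  have hcont : ContinuousAt (fun t => pochR t (n + 1)) x := (hD.1 0).continuousAt
  filter_upwards [hcont.eventually_ne hp] with t ht
  rw [BRealfun, div_mul_cancel₀ _ (pow_ne_zero _ ht)]

/-- rational values of the derivative -/
noncomputable def Fq (s n k : ℕ) : ℚ :=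
  s.factorial * PowerSeries.coeff s (Bps s n ((k : ℚ) + 1 / 4))

theorem Fq_real (s n k : ℕ) :
    (Fq s n k : ℝ) = iteratedDeriv s (BRealfun s n) ((k : ℝ) + 1 / 4) := by
  have h1 := tay_B s n ((k : ℝ) + 1 / 4) (by positivity)
  have h2 := Bps_map (Rat.castHom ℝ) s n ((k : ℚ) + 1 / 4) (fun i => by positivity)
  have h3 : (Rat.castHom ℝ) ((k : ℚ) + 1 / 4) = (k : ℝ) + 1 / 4 := by simp
  rw [h3, ← h1] at h2
  have h4 := congrArg (PowerSeries.coeff s) h2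
  simp only [PowerSeries.coeff_map, tay, PowerSeries.coeff_mk, Rat.coe_castHom] at h4
  rw [Fq]
  push_cast
  rw [h4]
  have : (s.factorial : ℝ) ≠ 0 := by positivity
  field_simp

theorem Fq_padic (s n k : ℕ) : (Fq s n k : ℚ_[2]) =
    s.factorial * PowerSeries.coeff s (Bps s n ((k : ℚ_[2]) + 1 / 4)) := by
  have h2 := Bps_map (Rat.castHom ℚ_[2]) s n ((k : ℚ) + 1 / 4) (fun i => by positivity)
  have h3 : (Rat.castHom ℚ_[2]) ((k : ℚ) + 1 / 4) = (k : ℚ_[2]) + 1 / 4 := by simp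
  rw [h3] at h2
  rw [Fq, ← h2, PowerSeries.coeff_map]
  simp

theorem odd_unit (j : ℕ) (hj : ¬ 2 ∣ j) : IsUnit (j : ℤ_[2]) := by
  rw [PadicInt.isUnit_iff]
  by_contra h
  have h1 : ‖((j : ℤ) : ℤ_[2])‖ < 1 := by
    push_cast
    exact lt_of_le_of_ne (PadicInt.norm_le_one _) h
  rw [PadicInt.norm_int_lt_one_iff_dvd] at h1
  exact hj (by exact_mod_cast h1)

theorem exists_quot (e j : ℕ) (hj : ¬ 2 ^ (e + 1) ∣ j) : ∃ c : ℤ_[2], c * j = 2 ^ e := by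
  have hj0 : j ≠ 0 := fun h => hj (by simp [h])
  obtain ⟨v, q, hq, rfl⟩ := Nat.exists_eq_pow_mul_and_not_dvd hj0 2 (by norm_num)
  have hv : v ≤ e := by
    by_contra h
    exact hj (Dvd.dvd.mul_right (pow_dvd_pow 2 (by omega)) q)
  obtain ⟨w, hw⟩ := odd_unit q hq
  refine ⟨2 ^ (e - v) * (w⁻¹ : ℤ_[2]ˣ), ?_⟩
  push_cast
  rw [← hw]
  calc _ = (2 : ℤ_[2]) ^ (e - v) * 2 ^ v * ((w⁻¹ : ℤ_[2]ˣ) * (w : ℤ_[2])) := by ring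
    _ = 2 ^ e := by rw [Units.inv_mul, mul_one, ← pow_add, Nat.sub_add_cancel hv]

theorem exists_gamma : ∃ γ : ℕ → ℤ_[2], (∀ l, γ l * ((l + 1) * (l + 2) : ℕ) = 2 ^ (l + 1)) ∧
    γ 0 = 1 ∧ ∀ l, 1 ≤ l → (2 : ℤ_[2]) ∣ γ l := by
  have key : ∀ l : ℕ, 1 ≤ l → ¬ 2 ^ (l + 1) ∣ (l + 1) * (l + 2) := by
    intro l hl h
    have hlt : ∀ l : ℕ, 1 ≤ l → l + 2 < 2 ^ (l + 1) := by
      intro l hl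
      induction l, hl using Nat.le_induction with
      | base => norm_num
      | succ k hk ih => rw [pow_succ]; omega
    have hcop : Nat.Coprime (l + 1) (l + 2) := by
      rw [show l + 2 = l + 1 + 1 from rfl]
      exact (Nat.coprime_self_add_right).2 (Nat.coprime_one_right _)
    have hpp : IsPrimePow (2 ^ (l + 1)) := Nat.prime_two.isPrimePow.pow (by omega)
    have := hlt l hl
    rcases (hcop.isPrimePow_dvd_mul hpp).1 h with h1 | h1
    · have := Nat.le_of_dvd (by omega) h1
      omega
    · have := Nat.le_of_dvd (by omega) h1
      omega
  have h : ∀ l : ℕ, ∃ g : ℤ_[2], g * ((l + 1) * (l + 2) : ℕ) = 2 ^ (l + 1) ∧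
      (l = 0 → g = 1) ∧ (1 ≤ l → (2 : ℤ_[2]) ∣ g) := by
    intro l
    rcases Nat.eq_zero_or_pos l with rfl | hl
    · exact ⟨1, by norm_num, fun _ => rfl, fun h => by omega⟩
    · obtain ⟨c, hc⟩ := exists_quot l _ (key l hl)
      exact ⟨2 * c, by rw [mul_assoc, hc]; ring, fun h => by omega, fun _ => dvd_mul_right _ _⟩
  choose γ h1 h2 h3 using h
  exact ⟨γ, h1, h2 0 rfl, h3⟩

open PowerSeries in
/-- the coefficient lemma -/
theorem coeff_lemma (s : ℕ) (γ : ℕ → ℤ_[2])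
    (hγ : ∀ l, γ l * ((l + 1) * (l + 2) : ℕ) = 2 ^ (l + 1)) (c : ℤ_[2]) (V : PowerSeries ℤ_[2]) :
    2 * (s.factorial : ℤ_[2]) * coeff s (((C c + X) * rescale 2 V) ^ (s + 2)) =
      ((s + 2).factorial : ℤ_[2]) *
        ∑ l ∈ Finset.range (s + 1), γ l * (s.choose l) * c ^ (l + 2) * coeff l (V ^ (s + 2)) := by
  rw [mul_pow, ← map_pow, coeff_mul, Finset.Nat.sum_antidiagonal_eq_sum_range_succ
    (fun i j => coeff i ((C c + X) ^ (s + 2)) * coeff j (rescale 2 (V ^ (s + 2)))),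
    ← Finset.sum_range_reflect, Finset.mul_sum, Finset.mul_sum]
  refine Finset.sum_congr rfl fun l hl => ?_
  have hl : l ≤ s := by simpa [Nat.lt_succ_iff] using hl
  obtain ⟨k, rfl⟩ := Nat.exists_eq_add_of_le hl
  have e1 : l + k + 1 - 1 - l = k := by omega
  have e2 : l + k - k = l := by omega
  simp only [e1, e2]
  have e3 : coeff k ((C c + X : PowerSeries ℤ_[2]) ^ (l + k + 2)) =
      c ^ (l + 2) * ((l + k + 2).choose k : ℕ) := by
    have : (C c + X : PowerSeries ℤ_[2]) ^ (l + k + 2) =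
        (((Polynomial.X + Polynomial.C c) ^ (l + k + 2) : Polynomial ℤ_[2]) :
          PowerSeries ℤ_[2]) := by
      simp [add_comm]
    rw [this, Polynomial.coeff_coe, Polynomial.coeff_X_add_C_pow]
    congr 2
    omega
  rw [e3, coeff_rescale]
  have hnat : (l + k).factorial * (l + k + 2).choose k * ((l + 1) * (l + 2)) =
      (l + k + 2).factorial * (l + k).choose l := by
    have h1 := Nat.add_choose_mul_factorial_mul_factorial l k
    have h2 := Nat.add_choose_mul_factorial_mul_factorial k (l + 2)
    rw [← Nat.choose_symm_add] at h1 h2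
    rw [show k + (l + 2) = l + k + 2 by ring] at h2
    rw [Nat.factorial_succ (l + 1), Nat.factorial_succ l] at h2
    rw [← h2]
    nth_rewrite 1 [← h1]
    ring
  have hz : ((l + k).factorial * (l + k + 2).choose k * ((l + 1) * (l + 2) : ℕ) : ℤ_[2]) =
      (l + k + 2).factorial * (l + k).choose l := by exact_mod_cast hnat
  have hne : (((l + 1) * (l + 2) : ℕ) : ℤ_[2]) ≠ 0 := by
    rw [Nat.cast_ne_zero]; positivity
  have hmain : 2 * ((l + k).factorial : ℤ_[2]) * (l + k + 2).choose k * 2 ^ l =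
      (l + k + 2).factorial * (γ l * (l + k).choose l) := by
    refine mul_right_cancel₀ hne ?_
    have := hγ l
    rw [pow_succ] at this
    linear_combination 2 * 2 ^ l * hz - ((l + k + 2).factorial : ℤ_[2]) * (l + k).choose l * this
  linear_combination c ^ (l + 2) * coeff l (V ^ (l + k + 2)) * hmain

open PowerSeries in
/-- the integral function whose Volkenborn integral is taken -/
noncomputable def Qf (s : ℕ) (γ : ℕ → ℤ_[2]) (V : ℕ → PowerSeries ℤ_[2]) (x : ℕ) : ℤ_[2] :=
  ∑ l ∈ Finset.range (s + 1),
    γ l * (s.choose l) * (1 + x) ^ (l + 2) * coeff l (V (2 * x) ^ (s + 2))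

open PowerSeries in
theorem Qf_C2_term (s l : ℕ) (V : ℕ → PowerSeries ℤ_[2]) (hV : C2 V) :
    C2 (fun x : ℕ => (s.choose l) * (1 + x : ℤ_[2]) ^ (l + 2) * coeff l (V (2 * x) ^ (s + 2))) := by
  have h1 : C2 (fun x : ℕ => (1 + x : ℤ_[2])) := by simpa using C2.lin (1 : ℤ_[2]) 1
  have h2 : C2 (fun x : ℕ => coeff l (V (2 * x) ^ (s + 2))) :=
    C2.map (coeff (R := ℤ_[2]) l).toAddMonoidHom ((hV.pow (s + 2)).comp_mul 2)
  exact ((C2.const _).mul (h1.pow _)).mul h2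

theorem Qf_C2 (s : ℕ) (γ : ℕ → ℤ_[2]) (V : ℕ → PowerSeries ℤ_[2]) (hV : C2 V) :
    C2 (Qf s γ V) := by
  refine C2.sum _ _ fun l _ => ?_
  have := (C2.const (γ l)).mul (Qf_C2_term s l V hV)
  simpa only [mul_assoc] using this

open PowerSeries in
theorem Qf_dvd (s : ℕ) (γ : ℕ → ℤ_[2]) (h0 : γ 0 = 1) (h1 : ∀ l, 1 ≤ l → (2 : ℤ_[2]) ∣ γ l)
    (V : ℕ → PowerSeries ℤ_[2]) (hV : C2 V) (u h : ℕ) :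
    (4 * h : ℤ_[2]) ∣ Qf s γ V (2 * (u + h)) - Qf s γ V (2 * u) := by
  rw [Qf, Qf, ← Finset.sum_sub_distrib]
  refine Finset.dvd_sum fun l _ => ?_
  rcases Nat.eq_zero_or_pos l with rfl | hl
  · have hc : C2 (fun x : ℕ => coeff 0 (V x ^ (s + 2))) :=
      C2.map (coeff (R := ℤ_[2]) 0).toAddMonoidHom (hV.pow (s + 2))
    obtain ⟨d, hd⟩ := hc.lip (2 * (2 * u)) (4 * h)
    rw [h0]
    rw [show 2 * (2 * (u + h)) = 2 * (2 * u) + 4 * h by ring]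
    push_cast at hd ⊢
    refine ⟨(1 + 2 * (u + h)) ^ 2 * d + (1 + 2 * u + h) * coeff 0 (V (2 * (2 * u)) ^ (s + 2)), ?_⟩
    simp only [Nat.choose_zero_right, Nat.cast_one]
    linear_combination (1 + 2 * (u + h) : ℤ_[2]) ^ 2 * hd
  · obtain ⟨g, hg⟩ := h1 l hl
    obtain ⟨d, hd⟩ := (Qf_C2_term s l V hV).lip (2 * u) (2 * h)
    rw [← mul_add] at hd
    refine ⟨g * d, ?_⟩
    rw [hg]
    push_cast at hd ⊢
    linear_combination 2 * g * hd

theorem two_dvd_not_unit : ¬ IsUnit (2 : ℤ_[2]) := by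
  have := PadicInt.p_nonunit (p := 2)
  simpa using this

open PowerSeries in
theorem Qf_unit (s : ℕ) (γ : ℕ → ℤ_[2]) (h0 : γ 0 = 1) (h1 : ∀ l, 1 ≤ l → (2 : ℤ_[2]) ∣ γ l)
    (V : ℕ → PowerSeries ℤ_[2]) (hV : IsUnit (constantCoeff (V 0))) : IsUnit (Qf s γ V 0) := by
  have hd : (2 : ℤ_[2]) ∣ Qf s γ V 0 - constantCoeff (V 0) ^ (s + 2) := by
    rw [Qf, Finset.sum_range_succ']
    simp only [h0, mul_zero]
    rw [add_sub_assoc]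
    refine dvd_add (Finset.dvd_sum fun l _ => ?_) ?_
    · exact (((h1 (l + 1) (by omega)).mul_right _).mul_right _).mul_right _
    · simp
  by_contra hu
  rw [PadicInt.not_isUnit_iff, PadicInt.norm_lt_one_iff_dvd] at hu
  have h3 : (2 : ℤ_[2]) ∣ constantCoeff (V 0) ^ (s + 2) := by
    have := dvd_sub (show (2 : ℤ_[2]) ∣ Qf s γ V 0 by exact_mod_cast hu) hd
    simpa using this
  exact two_dvd_not_unit (isUnit_of_dvd_unit h3 (hV.pow _))

section fam
open PowerSeries

/-- linear factor `α + β (y + X)` -/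
noncomputable def LF (α β : ℤ_[2]) (y : ℕ) : PowerSeries ℤ_[2] :=
  C α + C β * ((y : PowerSeries ℤ_[2]) + X)

theorem LF_C2 (α β : ℤ_[2]) : C2 (LF α β) := by
  have := C2.lin (C α + C β * X : PowerSeries ℤ_[2]) (C β)
  convert this using 2 with y
  rw [LF]; ring

theorem LF_cc (α β : ℤ_[2]) (y : ℕ) : constantCoeff (LF α β y) = α + β * y := by
  simp [LF]

theorem LF_rescale (α β : ℤ_[2]) (d u : ℕ) :
    PowerSeries.map io (rescale (d : ℤ_[2]) (LF α β (d * u))) =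
      C (io α) + C (io β) * ((d : PowerSeries ℚ_[2]) * ((u : PowerSeries ℚ_[2]) + X)) := by
  simp only [LF, map_add, map_mul, rescale_X, map_natCast, map_C, map_X, Nat.cast_mul]
  have hC : ∀ a : ℤ_[2], rescale (d : ℤ_[2]) (C a) = C a := fun a => by
    ext k; rw [coeff_rescale, coeff_C]; split_ifs with h <;> simp [h]
  simp only [hC, map_C]
  ring

/-- the denominator -/
noncomputable def De (n r w : ℕ) (y : ℕ) : PowerSeries ℤ_[2] :=
  ∏ j ∈ Finset.range (n + 1), LF (1 + 4 * j + 4 * r) w y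

theorem De_C2 (n r w : ℕ) : C2 (De n r w) := C2.prod _ _ fun _ _ => LF_C2 _ _

theorem De_unit (n r w : ℕ) (hw : 2 ∣ w) (y : ℕ) : IsUnit (De n r w y) := by
  rw [isUnit_iff_constantCoeff, De, map_prod]
  refine IsUnit.prod_iff.2 fun j _ => ?_
  rw [LF_cc]
  have := odd_unit (1 + 4 * j + 4 * r + w * y) (by
    obtain ⟨v, rfl⟩ := hw
    rw [mul_assoc]; omega)
  push_cast at this
  exact this

theorem De_eq (m n r w d u : ℕ) (hwd : w * d = 4 * 2 ^ m) :
    rescale ((2 : ℚ_[2]) ^ m) (NP (((r + 2 ^ m * u : ℕ) : ℚ_[2]) + 1 / 4) (n + 1)) * 4 ^ (n + 1) =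
      PowerSeries.map io (rescale (d : ℤ_[2]) (De n r w (d * u))) := by
  rw [De, NP, map_prod, map_prod, map_prod]
  conv_lhs => rw [← Finset.card_range (n + 1), ← Finset.prod_const, Finset.card_range,
    ← Finset.prod_mul_distrib]
  refine Finset.prod_congr rfl fun j _ => ?_
  rw [LF_rescale]
  have hC : ∀ a : ℚ_[2], rescale ((2 : ℚ_[2]) ^ m) (C a) = C a := fun a => by
    ext k; rw [coeff_rescale, coeff_C]; split_ifs with h <;> simp [h]
  have h4 : (C (1 / 4 : ℚ_[2])) * 4 = 1 := by
    rw [show (4 : PowerSeries ℚ_[2]) = C 4 from (map_ofNat C 4).symm, ← map_mul]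
    norm_num
  have hwd' : (w : PowerSeries ℚ_[2]) * d = 4 * 2 ^ m := by
    have := congrArg (Nat.cast : ℕ → PowerSeries ℚ_[2]) hwd
    push_cast at this; exact this
  have e4 : io 4 = 4 := map_ofNat io 4
  have c4 : (C (4 : ℚ_[2])) = 4 := map_ofNat C 4
  have c2 : (C (2 : ℚ_[2])) = 2 := map_ofNat C 2
  rw [map_add, hC, rescale_X]
  simp only [map_add, map_mul, map_natCast, map_one, map_pow, e4, c4, c2, Nat.cast_add,
    Nat.cast_mul, Nat.cast_pow, Nat.cast_ofNat]
  linear_combination h4 - ((u : PowerSeries ℚ_[2]) + X) * hwd'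

theorem alg {A : Type*} [CommRing A] (a : ℕ) (B D c q De DI N f L Nu : A)
    (h1 : B * D ^ a = c * N ^ a) (h2 : D * q = De) (h3 : De * DI = 1) (h4 : N = f * L * Nu) :
    B = c * f ^ a * q ^ a * (L * (Nu * DI)) ^ a := by
  calc B = B * (De * DI) ^ a := by rw [h3, one_pow, mul_one]
    _ = (B * D ^ a) * q ^ a * DI ^ a := by rw [← h2]; ring
    _ = _ := by rw [h1, h4]; ring

theorem quarter_ne (k i : ℕ) : (k : ℚ_[2]) + 1 / 4 + i ≠ 0 := by
  have : ((k : ℚ) + 1 / 4 + i) ≠ 0 := by positivity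
  have h : (((k : ℚ) + 1 / 4 + i : ℚ) : ℚ_[2]) ≠ 0 := by exact_mod_cast this
  push_cast at h
  exact h

/-- the common constant -/
noncomputable def kap (s n : ℕ) : ℚ_[2] :=
  2 ^ ((3 * s + 6) * n) * (n.factorial : ℚ_[2]) ^ (s + 2) * (4 ^ (n + 1)) ^ (s + 2)

theorem rescaleC {R : Type*} [CommRing R] (b a : R) : rescale b (C a) = C a := by
  ext k; rw [coeff_rescale, coeff_C]; split_ifs with h <;> simp [h]

set_option maxHeartbeats 2000000 in
theorem fam_zero (s m n : ℕ) (hm : 2 ≤ m) (hn : n = 2 ^ m - 1) :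
    ∃ V : ℕ → PowerSeries ℤ_[2], C2 V ∧ IsUnit (constantCoeff (V 0)) ∧ ∀ u : ℕ,
      rescale ((2 : ℚ_[2]) ^ m) (Bps s n (((2 ^ m * u : ℕ) : ℚ_[2]) + 1 / 4)) =
        C (kap s n) * PowerSeries.map io (rescale 2
          (((C (1 + (2 * u : ℕ) : ℤ_[2]) + X) * rescale 2 (V (2 * (2 * u)))) ^ (s + 2))) := by
  obtain ⟨e, rfl⟩ := Nat.exists_eq_add_of_le' hm
  have hc : ∀ i : ℕ, ∃ c : ℤ_[2], i ∈ (Finset.range n).erase (2 ^ (e + 1) - 1) →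
      c * ((i + 1 : ℕ) : ℤ_[2]) = 2 ^ e := by
    intro i
    by_cases hi : i ∈ (Finset.range n).erase (2 ^ (e + 1) - 1)
    · have h2 : ¬ 2 ^ (e + 1) ∣ i + 1 := by
        rintro ⟨q, hq⟩
        simp only [Finset.mem_erase, Finset.mem_range] at hi
        have h3 : (2 : ℕ) ^ (e + 2) = 2 ^ (e + 1) * 2 := pow_succ _ _
        have h4 : 0 < 2 ^ (e + 1) := by positivity
        have h5 : q < 2 := by
          by_contra h
          have : 2 ^ (e + 1) * 2 ≤ 2 ^ (e + 1) * q := Nat.mul_le_mul_left _ (by omega)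
          omega
        interval_cases q <;> omega
      obtain ⟨c, hc⟩ := exists_quot e _ h2
      exact ⟨c, fun _ => hc⟩
    · exact ⟨0, fun h => absurd h hi⟩
  choose c hc using hc
  set Nu : ℕ → PowerSeries ℤ_[2] := fun y =>
    ∏ i ∈ (Finset.range n).erase (2 ^ (e + 1) - 1), LF 1 (c i) y with hNu
  have hNuC : C2 Nu := C2.prod _ _ fun _ _ => LF_C2 _ _
  have hdu := De_unit n 0 (2 ^ (e + 2)) (dvd_pow_self 2 (by omega))
  have hdi : ∀ y, De n 0 (2 ^ (e + 2)) y * Ring.inverse (De n 0 (2 ^ (e + 2)) y) = 1 :=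
    fun y => Ring.mul_inverse_cancel _ (hdu y)
  refine ⟨fun y => Nu y * Ring.inverse (De n 0 (2 ^ (e + 2)) y),
    hNuC.mul ((De_C2 _ _ _).inv hdi), ?_, fun u => ?_⟩
  · have h1 : IsUnit (Ring.inverse (De n 0 (2 ^ (e + 2)) 0)) :=
      IsUnit.of_mul_eq_one _ (by rw [mul_comm]; exact hdi 0)
    rw [map_mul]
    refine IsUnit.mul ?_ (isUnit_iff_constantCoeff.1 h1)
    simp only [hNu, map_prod, LF_cc]
    simp
  · have hB := congrArg (rescale ((2 : ℚ_[2]) ^ (e + 2)))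
      (Bps_spec s n (((2 ^ (e + 2) * u : ℕ) : ℚ_[2]) + 1 / 4) (quarter_ne _))
    rw [map_mul, map_mul, rescaleC, map_pow, map_pow, map_pow] at hB
    have hD := De_eq (e + 2) n 0 (2 ^ (e + 2)) 4 u (by ring)
    rw [Nat.zero_add] at hD
    have hI := congrArg (fun z => PowerSeries.map io (rescale ((4 : ℕ) : ℤ_[2]) z)) (hdi (4 * u))
    simp only [map_mul, map_one] at hI
    have hN : rescale ((2 : ℚ_[2]) ^ (e + 2))
          (NP (((2 ^ (e + 2) * u : ℕ) : ℚ_[2]) + 1 / 4 + 3 / 4) n) =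
        C (n.factorial : ℚ_[2]) * PowerSeries.map io (rescale 2 (C (1 + (2 * u : ℕ) : ℤ_[2]) + X)) *
          PowerSeries.map io (rescale ((4 : ℕ) : ℤ_[2]) (Nu (4 * u))) := by
      have hmem : 2 ^ (e + 1) - 1 ∈ Finset.range n := by
        have h3 : (2 : ℕ) ^ (e + 2) = 2 ^ (e + 1) * 2 := pow_succ _ _
        have h4 : 0 < 2 ^ (e + 1) := by positivity
        rw [Finset.mem_range]; omega
      have c2 : (C (2 : ℚ_[2])) = 2 := map_ofNat C 2
      have i2 : io 2 = 2 := map_ofNat io 2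
      have hfac : ∀ i : ℕ, rescale ((2 : ℚ_[2]) ^ (e + 2))
          (C (((2 ^ (e + 2) * u : ℕ) : ℚ_[2]) + 1 / 4 + 3 / 4 + i) + X) =
          2 ^ (e + 2) * ((u : PowerSeries ℚ_[2]) + X) + ((i + 1 : ℕ) : PowerSeries ℚ_[2]) := by
        intro i
        have : ((2 ^ (e + 2) * u : ℕ) : ℚ_[2]) + 1 / 4 + 3 / 4 + i =
          ((2 ^ (e + 2) * u + (i + 1) : ℕ) : ℚ_[2]) := by push_cast; ring
        rw [this, map_add, rescaleC, rescale_X, map_natCast, map_pow, c2]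
        push_cast; ring
      rw [NP, map_prod, ← Finset.mul_prod_erase _ _ hmem, hfac]
      have hf : (n.factorial : PowerSeries ℚ_[2]) = (2 ^ (e + 1) : PowerSeries ℚ_[2]) *
          ∏ i ∈ (Finset.range n).erase (2 ^ (e + 1) - 1), ((i + 1 : ℕ) : PowerSeries ℚ_[2]) := by
        rw [← Finset.prod_range_add_one_eq_factorial, Nat.cast_prod,
          ← Finset.mul_prod_erase _ _ hmem,
          Nat.sub_add_cancel (Nat.one_le_two_pow)]
        push_cast; rfl
      rw [map_natCast, hf, hNu]
      simp only [map_prod]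
      have h0 : (2 ^ (e + 2) * ((u : PowerSeries ℚ_[2]) + X) +
          ((2 ^ (e + 1) - 1 + 1 : ℕ) : PowerSeries ℚ_[2])) =
          2 ^ (e + 1) * PowerSeries.map io (rescale 2 (C (1 + (2 * u : ℕ) : ℤ_[2]) + X)) := by
        rw [Nat.sub_add_cancel (Nat.one_le_two_pow)]
        rw [map_add, rescaleC, rescale_X]
        simp only [map_add, map_mul, map_C, map_X, map_one, map_natCast, i2, c2]
        push_cast; ring
      rw [h0]
      have h1 : ∏ i ∈ (Finset.range n).erase (2 ^ (e + 1) - 1), rescale ((2 : ℚ_[2]) ^ (e + 2))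
          (C (((2 ^ (e + 2) * u : ℕ) : ℚ_[2]) + 1 / 4 + 3 / 4 + i) + X) =
          (∏ i ∈ (Finset.range n).erase (2 ^ (e + 1) - 1), ((i + 1 : ℕ) : PowerSeries ℚ_[2])) *
          ∏ i ∈ (Finset.range n).erase (2 ^ (e + 1) - 1),
            PowerSeries.map io (rescale ((4 : ℕ) : ℤ_[2]) (LF 1 (c i) (4 * u))) := by
        rw [← Finset.prod_mul_distrib]
        refine Finset.prod_congr rfl fun i hi => ?_
        rw [hfac, LF_rescale]
        have := congrArg (fun z => (C (io z))) (hc i hi)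
        simp only [map_mul, map_natCast, map_pow, i2, c2] at this
        rw [map_one, map_one]
        push_cast at this ⊢
        linear_combination (-4 * ((u : PowerSeries ℚ_[2]) + X)) * this
      rw [h1]
      ring
    clear_value Nu
    have := alg _ _ _ _ _ _ _ _ _ _ _ hB hD hI hN
    rw [this]
    have hr : ∀ f : PowerSeries ℤ_[2], rescale 2 (rescale 2 f) = rescale ((4 : ℕ) : ℤ_[2]) f := by
      intro f; rw [rescale_rescale]; norm_num
    rw [map_pow, map_pow, map_mul, hr, map_mul, map_mul, map_mul, show 2 * (2 * u) = 4 * u by ring]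
    have c4 : (C (4 : ℚ_[2])) = 4 := map_ofNat C 4
    rw [kap, map_mul, map_mul, map_pow C (2 : ℚ_[2]) ((3 * s + 6) * n), map_pow C (n.factorial : ℚ_[2]), map_pow C (4 ^ (n + 1) : ℚ_[2]),
      map_pow C (4 : ℚ_[2]), c4]

set_option maxHeartbeats 2000000 in
theorem fam_ne (s m n r : ℕ) (hm : 2 ≤ m) (hn : n = 2 ^ m - 1) (hr0 : 1 ≤ r) (hr1 : r < 2 ^ m) :
    ∃ V : ℕ → PowerSeries ℤ_[2], C2 V ∧ ∀ u : ℕ,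
      rescale ((2 : ℚ_[2]) ^ m) (Bps s n (((r + 2 ^ m * u : ℕ) : ℚ_[2]) + 1 / 4)) =
        C (kap s n * 2 ^ (s + 2)) * PowerSeries.map io
          (((C (1 + (u : ℕ) : ℤ_[2]) + X) * rescale 2 (V (2 * u))) ^ (s + 2)) := by
  obtain ⟨e, rfl⟩ := Nat.exists_eq_add_of_le' (show 1 ≤ m by omega)
  obtain ⟨p, rfl⟩ := Nat.exists_eq_add_of_le' hr0
  obtain ⟨q, hq⟩ := Nat.exists_eq_add_of_le (show p + 1 ≤ n by omega)
  have hpow : 2 ^ (e + 1) = p + 1 + q + 1 := by omega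
  have hc : ∀ i : ℕ, ∃ c : ℤ_[2], i < n → c * ((i + 1 : ℕ) : ℤ_[2]) = 2 ^ e := by
    intro i
    by_cases hi : i < n
    · obtain ⟨c, hc⟩ := exists_quot e (i + 1) (fun h => by
        have := Nat.le_of_dvd (by omega) h
        omega)
      exact ⟨c, fun _ => hc⟩
    · exact ⟨0, fun h => absurd h hi⟩
  choose c hc using hc
  set Nu : ℕ → PowerSeries ℤ_[2] := fun y =>
    C (c p) * (∏ i ∈ Finset.range q, LF 1 (c (p + 1 + i)) y) *
      ∏ i ∈ Finset.range p, LF (1 + 2 * c i) (c i) y with hNu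
  have hNuC : C2 Nu := ((C2.const _).mul (C2.prod _ _ fun _ _ => LF_C2 _ _)).mul
    (C2.prod _ _ fun _ _ => LF_C2 _ _)
  have hdu := De_unit n (p + 1) (2 ^ (e + 2)) (dvd_pow_self 2 (by omega))
  have hdi : ∀ y, De n (p + 1) (2 ^ (e + 2)) y * Ring.inverse (De n (p + 1) (2 ^ (e + 2)) y) = 1 :=
    fun y => Ring.mul_inverse_cancel _ (hdu y)
  refine ⟨fun y => Nu y * Ring.inverse (De n (p + 1) (2 ^ (e + 2)) y),
    hNuC.mul ((De_C2 _ _ _).inv hdi), fun u => ?_⟩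
  have hB := congrArg (rescale ((2 : ℚ_[2]) ^ (e + 1)))
    (Bps_spec s n (((p + 1 + 2 ^ (e + 1) * u : ℕ) : ℚ_[2]) + 1 / 4) (quarter_ne _))
  rw [map_mul, map_mul, rescaleC, map_pow, map_pow, map_pow] at hB
  have hD := De_eq (e + 1) n (p + 1) (2 ^ (e + 2)) 2 u (by ring)
  have hI := congrArg (fun z => PowerSeries.map io (rescale ((2 : ℕ) : ℤ_[2]) z)) (hdi (2 * u))
  simp only [map_mul, map_one] at hI
  have c2 : (C (2 : ℚ_[2])) = 2 := map_ofNat C 2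
  have i2 : io 2 = 2 := map_ofNat io 2
  have hN : rescale ((2 : ℚ_[2]) ^ (e + 1))
        (NP (((p + 1 + 2 ^ (e + 1) * u : ℕ) : ℚ_[2]) + 1 / 4 + 3 / 4) n) =
      (C (n.factorial : ℚ_[2]) * 2) * PowerSeries.map io (C (1 + (u : ℕ) : ℤ_[2]) + X) *
        PowerSeries.map io (rescale ((2 : ℕ) : ℤ_[2]) (Nu (2 * u))) := by
    have hfac : ∀ i : ℕ, rescale ((2 : ℚ_[2]) ^ (e + 1))
        (C (((p + 1 + 2 ^ (e + 1) * u : ℕ) : ℚ_[2]) + 1 / 4 + 3 / 4 + i) + X) =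
        2 ^ (e + 1) * ((u : PowerSeries ℚ_[2]) + X) +
          ((p + 1 + i + 1 : ℕ) : PowerSeries ℚ_[2]) := by
      intro i
      have : ((p + 1 + 2 ^ (e + 1) * u : ℕ) : ℚ_[2]) + 1 / 4 + 3 / 4 + i =
        ((p + 1 + 2 ^ (e + 1) * u + (i + 1) : ℕ) : ℚ_[2]) := by push_cast; ring
      rw [this, map_add, rescaleC, rescale_X, map_natCast, map_pow, c2]
      push_cast; ring
    have hcc : ∀ i < n, C (io (c i)) * ((i + 1 : ℕ) : PowerSeries ℚ_[2]) = 2 ^ e := by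
      intro i hi
      have := congrArg (fun z => (C (io z))) (hc i hi)
      simpa only [map_mul, map_natCast, map_pow, i2, c2] using this
    have hpow' : (2 : PowerSeries ℚ_[2]) ^ (e + 1) = ((p + 1 + q + 1 : ℕ) : PowerSeries ℚ_[2]) := by
      rw [← hpow]; push_cast; rfl
    have hf : (n.factorial : PowerSeries ℚ_[2]) =
        (∏ i ∈ Finset.range p, ((i + 1 : ℕ) : PowerSeries ℚ_[2])) * ((p + 1 : ℕ)) *
          ∏ i ∈ Finset.range q, ((p + 1 + i + 1 : ℕ) : PowerSeries ℚ_[2]) := by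
      rw [← Finset.prod_range_add_one_eq_factorial, Nat.cast_prod, hq, Finset.prod_range_add,
        Finset.prod_range_succ]
    rw [NP, map_prod, Finset.prod_congr rfl (fun i _ => hfac i), map_natCast, hf, hNu]
    simp only [map_mul, map_prod]
    rw [show n = q + 1 + p by omega, Finset.prod_range_add, Finset.prod_range_succ]
    have h1 : ∏ i ∈ Finset.range q, (2 ^ (e + 1) * ((u : PowerSeries ℚ_[2]) + X) +
          ((p + 1 + i + 1 : ℕ) : PowerSeries ℚ_[2])) =
        (∏ i ∈ Finset.range q, ((p + 1 + i + 1 : ℕ) : PowerSeries ℚ_[2])) *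
        ∏ i ∈ Finset.range q,
          PowerSeries.map io (rescale ((2 : ℕ) : ℤ_[2]) (LF 1 (c (p + 1 + i)) (2 * u))) := by
      rw [← Finset.prod_mul_distrib]
      refine Finset.prod_congr rfl fun i hi => ?_
      rw [Finset.mem_range] at hi
      have := hcc (p + 1 + i) (by omega)
      rw [LF_rescale, map_one, map_one, pow_succ]
      push_cast at this ⊢
      linear_combination (-2 * ((u : PowerSeries ℚ_[2]) + X)) * this
    have h2 : ∏ i ∈ Finset.range p, (2 ^ (e + 1) * ((u : PowerSeries ℚ_[2]) + X) +
          ((p + 1 + (q + 1 + i) + 1 : ℕ) : PowerSeries ℚ_[2])) =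
        (∏ i ∈ Finset.range p, ((i + 1 : ℕ) : PowerSeries ℚ_[2])) *
        ∏ i ∈ Finset.range p,
          PowerSeries.map io (rescale ((2 : ℕ) : ℤ_[2]) (LF (1 + 2 * c i) (c i) (2 * u))) := by
      rw [← Finset.prod_mul_distrib]
      refine Finset.prod_congr rfl fun i hi => ?_
      rw [Finset.mem_range] at hi
      have := hcc i (by omega)
      rw [LF_rescale]
      simp only [map_add, map_mul, map_one, i2, c2]
      rw [pow_succ] at hpow' ⊢
      push_cast at this hpow' ⊢
      linear_combination (-2 * (1 + (u : PowerSeries ℚ_[2]) + X)) * this - hpow'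
    have h3 : (2 ^ (e + 1) * ((u : PowerSeries ℚ_[2]) + X) +
          ((p + 1 + q + 1 : ℕ) : PowerSeries ℚ_[2])) =
        ((p + 1 : ℕ) : PowerSeries ℚ_[2]) * 2 * PowerSeries.map io (C (1 + (u : ℕ) : ℤ_[2]) + X) *
          PowerSeries.map io (rescale ((2 : ℕ) : ℤ_[2]) (C (c p))) := by
      have := hcc p (by omega)
      rw [← hpow', rescaleC, pow_succ]
      simp only [map_add, map_C, map_X, map_one, map_natCast]
      linear_combination (-2 * (1 + (u : PowerSeries ℚ_[2]) + X)) * this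
    rw [h1, h2, h3]
    ring
  clear_value Nu
  have := alg _ _ _ _ _ _ _ _ _ _ _ hB hD hI hN
  rw [this]
  rw [map_pow, map_mul, map_mul, map_mul, Nat.cast_ofNat]
  have c4 : (C (4 : ℚ_[2])) = 4 := map_ofNat C 4
  rw [kap, map_mul, map_mul, map_mul, map_pow C (2 : ℚ_[2]) ((3 * s + 6) * n), map_pow C (n.factorial : ℚ_[2]),
    map_pow C (4 ^ (n + 1) : ℚ_[2]), map_pow C (4 : ℚ_[2]), map_pow C (2 : ℚ_[2]) (s + 2), c4, c2]
  ring

end fam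

theorem sum_split {A : Type*} [AddCommMonoid A] (f : ℕ → A) (a b : ℕ) :
    ∑ k ∈ Finset.range (a * b), f k =
      ∑ r ∈ Finset.range a, ∑ u ∈ Finset.range b, f (r + a * u) := by
  rw [Finset.sum_comm]
  induction b with
  | zero => simp
  | succ b ih =>
    rw [Nat.mul_succ, Finset.sum_range_add, ih, Finset.sum_range_succ _ b]
    simp only [add_comm]

theorem tendsto_split (F : ℕ → ℚ_[2]) (m : ℕ) (K : ℕ → ℚ_[2]) (f : ℕ → ℕ → ℤ_[2]) (I : ℕ → ℚ_[2])
    (hF : ∀ r < 2 ^ m, ∀ u, F (r + 2 ^ m * u) = K r * io (f r u))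
    (hI : ∀ r < 2 ^ m, Tendsto (VS (f r)) atTop (nhds (I r))) :
    Tendsto (fun M : ℕ => (2 ^ M : ℚ_[2])⁻¹ * ∑ k ∈ Finset.range (2 ^ M), F k) atTop
      (nhds ((2 ^ m : ℚ_[2])⁻¹ * ∑ r ∈ Finset.range (2 ^ m), K r * I r)) := by
  rw [← tendsto_add_atTop_iff_nat m]
  have h : ∀ N : ℕ, (2 ^ (N + m) : ℚ_[2])⁻¹ * ∑ k ∈ Finset.range (2 ^ (N + m)), F k =
      (2 ^ m : ℚ_[2])⁻¹ * ∑ r ∈ Finset.range (2 ^ m), K r * VS (f r) N := by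
    intro N
    rw [show 2 ^ (N + m) = 2 ^ m * 2 ^ N from by rw [pow_add, mul_comm], sum_split,
      pow_add, mul_inv, mul_comm (2 ^ N : ℚ_[2])⁻¹, mul_assoc, Finset.mul_sum]
    congr 1
    refine Finset.sum_congr rfl fun r hr => ?_
    rw [Finset.sum_congr rfl fun u _ => hF r (Finset.mem_range.1 hr) u, ← Finset.mul_sum, VS,
      map_sum]
    ring
  simp only [h]
  refine Tendsto.const_mul _ (tendsto_finsetSum _ fun r hr => ?_)
  exact (hI r (Finset.mem_range.1 hr)).const_mul _

open PowerSeries in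
theorem F_zero (s m n : ℕ) (γ : ℕ → ℤ_[2])
    (hγ : ∀ l, γ l * ((l + 1) * (l + 2) : ℕ) = 2 ^ (l + 1)) (V : ℕ → PowerSeries ℤ_[2]) (u : ℕ)
    (hV : rescale ((2 : ℚ_[2]) ^ m) (Bps s n (((2 ^ m * u : ℕ) : ℚ_[2]) + 1 / 4)) =
        C (kap s n) * PowerSeries.map io (rescale 2
          (((C (1 + (2 * u : ℕ) : ℤ_[2]) + X) * rescale 2 (V (2 * (2 * u)))) ^ (s + 2)))) :
    (Fq s n (2 ^ m * u) : ℚ_[2]) = (2 * (2 ^ m) ^ s)⁻¹ * kap s n * (s + 2).factorial * 2 ^ s *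
      io (Qf s γ V (2 * u)) := by
  have h := congrArg (coeff s) hV
  rw [coeff_rescale, coeff_C_mul, coeff_map, coeff_rescale, map_mul, map_pow, map_ofNat] at h
  have h2 := congrArg io (coeff_lemma s γ hγ (1 + (2 * u : ℕ)) (V (2 * (2 * u))))
  rw [map_mul, map_mul, map_ofNat, map_natCast, map_mul, map_natCast] at h2
  rw [Fq_padic, Qf]
  generalize coeff s (Bps s n (((2 ^ m * u : ℕ) : ℚ_[2]) + 1 / 4)) = x at h ⊢
  have h0 : (2 * (2 ^ m) ^ s : ℚ_[2]) ≠ 0 := mul_ne_zero two_ne_zero (pow_ne_zero _ (pow_ne_zero _ two_ne_zero))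
  rw [mul_assoc, mul_assoc, mul_assoc, eq_inv_mul_iff_mul_eq₀ h0]
  linear_combination (2 * (s.factorial : ℚ_[2])) * h + kap s n * 2 ^ s * h2

open PowerSeries in
theorem F_ne (s m n r : ℕ) (γ : ℕ → ℤ_[2])
    (hγ : ∀ l, γ l * ((l + 1) * (l + 2) : ℕ) = 2 ^ (l + 1)) (V : ℕ → PowerSeries ℤ_[2]) (u : ℕ)
    (hV : rescale ((2 : ℚ_[2]) ^ m) (Bps s n (((r + 2 ^ m * u : ℕ) : ℚ_[2]) + 1 / 4)) =
        C (kap s n * 2 ^ (s + 2)) * PowerSeries.map io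
          (((C (1 + (u : ℕ) : ℤ_[2]) + X) * rescale 2 (V (2 * u))) ^ (s + 2))) :
    (Fq s n (r + 2 ^ m * u) : ℚ_[2]) =
      (2 * (2 ^ m) ^ s)⁻¹ * kap s n * (s + 2).factorial * 2 ^ s * 4 * io (Qf s γ V u) := by
  have h := congrArg (coeff s) hV
  rw [coeff_rescale, coeff_C_mul, coeff_map] at h
  have h2 := congrArg io (coeff_lemma s γ hγ (1 + (u : ℕ)) (V (2 * u)))
  rw [map_mul, map_mul, map_ofNat, map_natCast, map_mul, map_natCast] at h2
  rw [Fq_padic, Qf]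
  generalize coeff s (Bps s n (((r + 2 ^ m * u : ℕ) : ℚ_[2]) + 1 / 4)) = x at h ⊢
  have h0 : (2 * (2 ^ m) ^ s : ℚ_[2]) ≠ 0 :=
    mul_ne_zero two_ne_zero (pow_ne_zero _ (pow_ne_zero _ two_ne_zero))
  rw [mul_assoc, mul_assoc, mul_assoc, mul_assoc, eq_inv_mul_iff_mul_eq₀ h0]
  linear_combination (2 * (s.factorial : ℚ_[2])) * h + kap s n * 2 ^ s * 4 * h2

theorem val_factorial (m n : ℕ) (hn : n = 2 ^ m - 1) :
    padicValNat 2 n.factorial + m = n := by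
  have h1 : ∀ m : ℕ, padicValNat 2 (2 ^ m).factorial + 1 = 2 ^ m := by
    intro m
    induction m with
    | zero => simp
    | succ m ih =>
      rw [pow_succ', padicValNat_factorial_mul]
      omega
  have h2 : (2 ^ m).factorial = 2 ^ m * n.factorial := by
    have : 2 ^ m = n + 1 := by
      have := Nat.one_le_two_pow (n := m)
      omega
    rw [this, Nat.factorial_succ]
  have h3 := h1 m
  have := Nat.one_le_two_pow (n := m)
  rw [h2, padicValNat.mul (by positivity) (Nat.factorial_ne_zero n), padicValNat.prime_pow] at h3
  omega

theorem dlcm_ne_zero (n : ℕ) : dlcm n ≠ 0 := by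
  rw [dlcm, Ne, Finset.lcm_eq_zero_iff]
  simp

theorem val_dlcm (m n : ℕ) (hm : 2 ≤ m) (hn : n = 2 ^ m - 1) : padicValNat 2 (dlcm n) + 1 = m := by
  obtain ⟨e, rfl⟩ := Nat.exists_eq_add_of_le' (show 1 ≤ m by omega)
  have hp : 2 ^ (e + 1) = 2 ^ e * 2 := pow_succ _ _
  have hpos : 0 < 2 ^ e := by positivity
  have h1 : 2 ^ e ∣ dlcm n := by
    refine Finset.dvd_lcm (f := id) (b := 2 ^ e) ?_
    rw [Finset.mem_Icc]; omega
  have h2 : ¬ 2 ^ (e + 1) ∣ dlcm n := by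
    intro h
    have h3 : dlcm n ∣ 2 ^ e * (n.factorial / 2 ^ n.factorial.factorization 2) := by
      refine Finset.lcm_dvd fun b hb => ?_
      rw [Finset.mem_Icc] at hb
      have hb0 : b ≠ 0 := by omega
      have h4 := Nat.ordProj_mul_ordCompl_eq_self b 2
      rw [id, ← h4]
      refine mul_dvd_mul ?_ (Nat.ordCompl_dvd_ordCompl_of_dvd
        (Nat.dvd_factorial (by omega) hb.2) 2)
      refine pow_dvd_pow _ ?_
      have h5 := Nat.ordProj_le 2 hb0
      have h6 : 2 ^ b.factorization 2 < 2 ^ (e + 1) := by omega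
      have := (Nat.pow_lt_pow_iff_right (by norm_num)).1 h6
      omega
    have h4 := h.trans h3
    rw [pow_succ] at h4
    have h5 := Nat.dvd_of_mul_dvd_mul_left hpos h4
    exact Nat.not_dvd_ordCompl Nat.prime_two (Nat.factorial_ne_zero n) h5
  rw [padicValNat_dvd_iff_le (dlcm_ne_zero n)] at h1 h2
  omega

theorem val_two : (2 : ℚ_[2]).valuation = 1 := by
  have := Padic.valuation_p (p := 2)
  exact_mod_cast this

theorem kap_ne (s n : ℕ) : kap s n ≠ 0 := by
  have h : (n.factorial : ℚ_[2]) ≠ 0 := Nat.cast_ne_zero.2 (Nat.factorial_ne_zero n)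
  have h4 : (4 : ℚ_[2]) ≠ 0 := by norm_num
  exact mul_ne_zero (mul_ne_zero (pow_ne_zero _ two_ne_zero) (pow_ne_zero _ h))
    (pow_ne_zero _ (pow_ne_zero _ h4))

theorem val_kap (s n : ℕ) : (kap s n).valuation =
    (3 * s + 6) * n + (s + 2) * padicValNat 2 n.factorial + (s + 2) * ((n + 1) * 2) := by
  have h : (n.factorial : ℚ_[2]) ≠ 0 := Nat.cast_ne_zero.2 (Nat.factorial_ne_zero n)
  have h4 : (4 : ℚ_[2]) ≠ 0 := by norm_num
  have v4 : (4 : ℚ_[2]).valuation = 2 := by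
    rw [show (4 : ℚ_[2]) = 2 ^ 2 by norm_num, Padic.valuation_pow, val_two]; norm_num
  rw [kap, Padic.valuation_mul (mul_ne_zero (pow_ne_zero _ two_ne_zero) (pow_ne_zero _ h))
    (pow_ne_zero _ (pow_ne_zero _ h4)), Padic.valuation_mul (pow_ne_zero _ two_ne_zero)
    (pow_ne_zero _ h)]
  simp only [Padic.valuation_pow, val_two, v4, Padic.valuation_natCast]
  push_cast
  ring

theorem bracket (K : ℕ) (I : ℕ → ℚ_[2]) (h0 : ‖I 0‖ = 1) (h : ∀ r, ‖I r‖ ≤ 2) :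
    ‖I 0 + 4 * ∑ r ∈ Finset.range K, I (r + 1)‖ = 1 := by
  have h1 : ‖∑ r ∈ Finset.range K, I (r + 1)‖ ≤ 2 :=
    IsUltrametricDist.norm_sum_le_of_forall_le_of_nonneg (by norm_num) fun r _ => h _
  have h2 : ‖4 * ∑ r ∈ Finset.range K, I (r + 1)‖ ≤ 2⁻¹ := by
    rw [norm_mul, show (4 : ℚ_[2]) = 2 * 2 by norm_num, norm_mul, n2]
    linarith
  have h3 : ‖I 0‖ ≠ ‖4 * ∑ r ∈ Finset.range K, I (r + 1)‖ := by
    rw [h0]; intro h; rw [← h] at h2; norm_num at h2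
  rw [Padic.add_eq_max_of_ne h3, h0]
  exact max_eq_left (h2.trans (by norm_num))

theorem exists_data (s m n : ℕ) (hm : 2 ≤ m) (hn : n = 2 ^ m - 1) :
    ∃ I : ℕ → ℚ_[2], ‖I 0‖ = 1 ∧ (∀ r, ‖I r‖ ≤ 2) ∧
      Tendsto (fun M : ℕ => (2 ^ M : ℚ_[2])⁻¹ * ∑ k ∈ Finset.range (2 ^ M), (Fq s n k : ℚ_[2]))
        atTop (nhds ((2 ^ m : ℚ_[2])⁻¹ *
          ((2 * (2 ^ m) ^ s)⁻¹ * kap s n * (s + 2).factorial * 2 ^ s *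
            (I 0 + 4 * ∑ r ∈ Finset.range n, I (r + 1))))) := by
  obtain ⟨γ, hγ, g0, g1⟩ := exists_gamma
  obtain ⟨V, hV, hV0, hVF⟩ := fam_zero s m n hm hn
  have key : ∀ r : ℕ, ∃ (f : ℕ → ℤ_[2]) (J : ℚ_[2]), Tendsto (VS f) atTop (nhds J) ∧ ‖J‖ ≤ 2 ∧
      (r = 0 → ‖J‖ = 1) ∧ (r < 2 ^ m → ∀ u, (Fq s n (r + 2 ^ m * u) : ℚ_[2]) =
        ((2 * (2 ^ m) ^ s)⁻¹ * kap s n * (s + 2).factorial * 2 ^ s * (if r = 0 then 1 else 4)) *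
          io (f u)) := by
    intro r
    rcases Nat.eq_zero_or_pos r with rfl | hr
    · have hC : C2 (fun u => Qf s γ V (2 * u)) := (Qf_C2 s γ V hV).comp_mul 2
      obtain ⟨J, hJ, hJ2⟩ := VS_tendsto hC
      refine ⟨_, J, hJ, hJ2, fun _ => VS_unit (Qf_dvd s γ g0 g1 V hV) (Qf_unit s γ g0 g1 V hV0) hJ,
        fun _ u => ?_⟩
      rw [if_pos rfl, mul_one, Nat.zero_add]
      exact F_zero s m n γ hγ V u (hVF u)
    · by_cases hr1 : r < 2 ^ m
      · obtain ⟨W, hW, hWF⟩ := fam_ne s m n r hm hn hr hr1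
        obtain ⟨J, hJ, hJ2⟩ := VS_tendsto (Qf_C2 s γ W hW)
        refine ⟨_, J, hJ, hJ2, fun h => absurd h hr.ne', fun _ u => ?_⟩
        rw [if_neg hr.ne']
        exact F_ne s m n r γ hγ W u (hWF u)
      · refine ⟨fun _ => 0, 0, ?_, by simp, fun h => absurd h hr.ne', fun h => absurd h hr1⟩
        have : VS (fun _ => 0) = fun _ => 0 := by
          funext N; simp [VS]
        rw [this]
        exact tendsto_const_nhds
  choose f I hI hI2 hI0 hF using key
  refine ⟨I, hI0 0 rfl, hI2, ?_⟩
  have h := tendsto_split (fun k => (Fq s n k : ℚ_[2])) m _ f I hF (fun r _ => hI r)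
  convert h using 3
  rw [show 2 ^ m = n + 1 by have := Nat.one_le_two_pow (n := m); omega, Finset.sum_range_succ']
  simp only [Nat.add_eq_zero_iff, one_ne_zero, and_false, if_false, if_true]
  simp only [mul_assoc, ← Finset.mul_sum]
  ring

theorem volkenborn_integral_Tn_valuation (s : ℕ)
    (m : ℕ) (hm : 2 ≤ m) (n : ℕ) (hn : n = 2 ^ m - 1) :
    ∃ (F : ℕ → ℚ) (T : ℚ_[2]),
      (∀ k : ℕ, (F k : ℝ) = iteratedDeriv s (BRealfun s n) ((k : ℝ) + 1/4)) ∧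
      Filter.Tendsto
        (fun M : ℕ => (2 ^ M : ℚ_[2])⁻¹ * ∑ k ∈ Finset.range (2 ^ M), ((F k : ℚ_[2])))
        Filter.atTop (nhds T) ∧
      T ≠ 0 ∧
      ((dlcm n : ℚ_[2]) ^ (2 * s + 3) * T).valuation =
        ((6 * s + 12) * n + s + padicValNat 2 (Nat.factorial (s + 2)) : ℕ) := by
  obtain ⟨I, hI0, hI2, hT⟩ := exists_data s m n hm hn
  have hb := bracket n I hI0 hI2
  set b := I 0 + 4 * ∑ r ∈ Finset.range n, I (r + 1) with hbdef
  have hb0 : b ≠ 0 := by rintro h; rw [h, norm_zero] at hb; exact zero_ne_one hb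
  have hvb : b.valuation = 0 := by
    have h := Padic.norm_eq_zpow_neg_valuation hb0
    rw [hb] at h
    have h1 := zpow_right_injective₀ (a := ((2 : ℕ) : ℝ)) (by norm_num) (by norm_num)
      (show ((2 : ℕ) : ℝ) ^ (0 : ℤ) = ((2 : ℕ) : ℝ) ^ (-b.valuation) by rw [← h, zpow_zero])
    omega
  have h2 : (2 : ℚ_[2]) ≠ 0 := two_ne_zero
  have h2m : (2 ^ m : ℚ_[2]) ≠ 0 := pow_ne_zero _ h2
  have hA : (2 * (2 ^ m) ^ s : ℚ_[2]) ≠ 0 := mul_ne_zero h2 (pow_ne_zero _ h2m)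
  have hk := kap_ne s n
  have hfac : ((s + 2).factorial : ℚ_[2]) ≠ 0 := Nat.cast_ne_zero.2 (Nat.factorial_ne_zero _)
  have hd : (dlcm n : ℚ_[2]) ≠ 0 := Nat.cast_ne_zero.2 (dlcm_ne_zero n)
  have h2s : (2 ^ s : ℚ_[2]) ≠ 0 := pow_ne_zero _ h2
  have e1 := mul_ne_zero (inv_ne_zero hA) hk
  have e2 := mul_ne_zero e1 hfac
  have e3 := mul_ne_zero e2 h2s
  have e4 := mul_ne_zero e3 hb0
  have e5 := mul_ne_zero (inv_ne_zero h2m) e4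
  refine ⟨Fq s n, _, fun k => Fq_real s n k, hT, e5, ?_⟩
  rw [Padic.valuation_mul (pow_ne_zero _ hd) e5, Padic.valuation_mul (inv_ne_zero h2m) e4,
    Padic.valuation_mul e3 hb0, Padic.valuation_mul e2 h2s, Padic.valuation_mul e1 hfac,
    Padic.valuation_mul (inv_ne_zero hA) hk, Padic.valuation_inv, Padic.valuation_inv,
    Padic.valuation_mul h2 (pow_ne_zero _ h2m), val_kap, hvb]
  simp only [Padic.valuation_pow, val_two, Padic.valuation_natCast]
  have v1 : (padicValNat 2 n.factorial : ℤ) = n - m := by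
    have := val_factorial m n hn; omega
  have v2 : (padicValNat 2 (dlcm n) : ℤ) = m - 1 := by
    have := val_dlcm m n hm hn; omega
  rw [v1, v2]
  push_cast
  ring
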